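/- Let G be a finite simple graph with ε_G edges and let 𝓕_G(λ,μ) = det[ λI − (𝓐(G) − μ·𝓓(G)) ] be its generalized characteristic polynomial. Then (∂𝓕_G/∂μ)(0,1) = 2 ε_G κ(G). -/

import Mathlib

open scoped Classical
noncomputable section

/-- The finset of spanning trees of a finite simple graph `G`. -/
def spanningTrees {V : Type*} [Fintype V] [DecidableEq V] (G : SimpleGraph V) :
    Finset (SimpleGraph V) :=
  Finset.univ.filter fun T => T ≤ G ∧ T.IsTree
/-- `f` is the parent map of a tree on all of `V` rooted at `r`: it fixes `r`, and some height
function strictly decreases along `f` away from `r`. -/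
def IsParentMap {V : Type*} (r : V) (f : V → V) : Prop :=
  f r = r ∧ ∃ d : V → ℕ, ∀ i, i ≠ r → d (f i) < d i

/-- The graph joining each vertex to its image under `f`. -/
def parentGraph {V : Type*} (f : V → V) : SimpleGraph V :=
  SimpleGraph.fromRel fun i j => f i = j

theorem parentGraph_adj {V : Type*} {f : V → V} {i j : V} :
    (parentGraph f).Adj i j ↔ i ≠ j ∧ (f i = j ∨ f j = i) :=
  Iff.rfl

namespace IsParentMap

variable {V : Type*} {r : V} {f g : V → V}

theorem apply_ne (hf : IsParentMap r f) {i : V} (hi : i ≠ r) : f i ≠ i := by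
  obtain ⟨-, d, hd⟩ := hf
  intro h
  have := hd i hi
  rw [h] at this
  exact lt_irrefl _ this

theorem induction (hf : IsParentMap r f) {p : V → Prop} (root : p r)
    (step : ∀ i, i ≠ r → p (f i) → p i) (i : V) : p i := by
  obtain ⟨-, d, hd⟩ := hf
  induction h : d i using Nat.strong_induction_on generalizing i with
  | _ n ih =>
    by_cases hi : i = r
    · exact hi ▸ root
    · exact step i hi (ih _ (h ▸ hd i hi) _ rfl)

theorem connected (hf : IsParentMap r f) : (parentGraph f).Connected := by
  have hr : ∀ i, (parentGraph f).Reachable i r := by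
    refine hf.induction (SimpleGraph.Reachable.refl r) fun i hi h => ?_
    exact (SimpleGraph.Adj.reachable
      (parentGraph_adj.2 ⟨(hf.apply_ne hi).symm, Or.inl rfl⟩)).trans h
  have : Nonempty V := ⟨r⟩
  exact ⟨fun i j => (hr i).trans (hr j).symm⟩

theorem edgeSet_subset_image (hf : IsParentMap r f) :
    (parentGraph f).edgeSet ⊆ Set.image (fun i => s(i, f i)) {r}ᶜ := by
  intro e
  induction e using Sym2.ind with
  | _ i j =>
    rw [SimpleGraph.mem_edgeSet, parentGraph_adj]
    rintro ⟨hij, rfl | rfl⟩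
    · exact ⟨i, fun h => hij (by rw [h, hf.1]), rfl⟩
    · exact ⟨j, fun h => hij (by rw [h, hf.1]), Sym2.eq_swap⟩

theorem isTree [Finite V] (hf : IsParentMap r f) : (parentGraph f).IsTree := by
  refine SimpleGraph.isTree_iff_connected_and_card.2 ⟨hf.connected, le_antisymm ?_
    hf.connected.card_vert_le_card_edgeSet_add_one⟩
  have h : Nat.card (parentGraph f).edgeSet ≤ ({r}ᶜ : Set V).ncard := by
    rw [Nat.card_coe_set_eq]
    exact (Set.ncard_le_ncard hf.edgeSet_subset_image (Set.toFinite _)).trans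
      (Set.ncard_image_le (Set.toFinite _))
  have h' := Set.ncard_add_ncard_compl ({r} : Set V)
  rw [Set.ncard_singleton] at h'
  omega

theorem eq_of_parentGraph_eq (hf : IsParentMap r f) (hg : IsParentMap r g)
    (h : parentGraph f = parentGraph g) : f = g := by
  refine funext fun i => hg.induction (p := fun i => f i = g i)
    (hf.1.trans hg.1.symm) (fun i hi ih => ?_) i
  have hadj : (parentGraph f).Adj i (g i) := by
    rw [h]
    exact parentGraph_adj.2 ⟨(hg.apply_ne hi).symm, Or.inl rfl⟩
  rcases (parentGraph_adj.1 hadj).2 with h₁ | h₁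
  · exact h₁
  · exfalso
    obtain ⟨hgr, d, hd⟩ := hg
    have h₂ : g (g i) = i := ih ▸ h₁
    by_cases h₃ : g i = r
    · exact hi (by rw [← h₂, h₃, hgr])
    · have h₄ := hd i hi
      have h₅ := hd _ h₃
      rw [h₂] at h₅
      omega

theorem parentGraph_le {G : SimpleGraph V} (hf : IsParentMap r f)
    (hG : ∀ i, i ≠ r → G.Adj i (f i)) : parentGraph f ≤ G := by
  intro i j hij
  obtain ⟨hne, rfl | rfl⟩ := parentGraph_adj.1 hij
  · exact hG i fun h => hne (by rw [h, hf.1])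
  · exact (hG j fun h => hne (by rw [h, hf.1])).symm

end IsParentMap

theorem SimpleGraph.Connected.exists_adj_dist_lt {V : Type*} {T : SimpleGraph V}
    (hT : T.Connected) {i r : V} (hi : i ≠ r) : ∃ j, T.Adj i j ∧ T.dist j r < T.dist i r := by
  obtain ⟨p, hp⟩ := hT.exists_walk_length_eq_dist i r
  cases p with
  | nil => exact absurd rfl hi
  | cons h q =>
    refine ⟨_, h, ?_⟩
    have := SimpleGraph.dist_le q
    rw [SimpleGraph.Walk.length_cons] at hp
    omega

theorem SimpleGraph.IsTree.exists_isParentMap {V : Type*} {T : SimpleGraph V} (hT : T.IsTree)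
    (r : V) : ∃ f, IsParentMap r f ∧ (∀ i, i ≠ r → T.Adj i (f i)) ∧ parentGraph f = T := by
  choose! f hadj hlt using fun i (hi : i ≠ r) => hT.connected.exists_adj_dist_lt hi
  have hf : IsParentMap r (Function.update f r r) :=
    ⟨by simp, fun i => T.dist i r, fun i hi => by simpa [hi] using hlt i hi⟩
  have hfT : ∀ i, i ≠ r → T.Adj i (Function.update f r r i) := fun i hi => by
    simpa [hi] using hadj i hi
  have hle := hf.parentGraph_le hfT
  exact ⟨_, hf, hfT, le_antisymm hle
    ((SimpleGraph.isTree_iff_minimal_connected.1 hT).2 hf.connected hle)⟩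

theorem card_spanningTrees_eq_card_parentMaps {V : Type*} [Fintype V] [DecidableEq V]
    (G : SimpleGraph V) (r : V) :
    (Finset.univ.filter fun f : V → V => IsParentMap r f ∧ ∀ i, i ≠ r → G.Adj i (f i)).card =
      (spanningTrees G).card := by
  refine Finset.card_bij (fun f _ => parentGraph f) ?_ ?_ ?_
  · intro f hf
    obtain ⟨hf, hG⟩ := (Finset.mem_filter.1 hf).2
    exact Finset.mem_filter.2 ⟨Finset.mem_univ _, hf.parentGraph_le hG, hf.isTree⟩
  · intro f hf g hg h
    exact (Finset.mem_filter.1 hf).2.1.eq_of_parentGraph_eq (Finset.mem_filter.1 hg).2.1 h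
  · intro T hT
    obtain ⟨hle, hT⟩ := (Finset.mem_filter.1 hT).2
    obtain ⟨f, hf, hadj, rfl⟩ := hT.exists_isParentMap r
    exact ⟨f, Finset.mem_filter.2 ⟨Finset.mem_univ _, hf, fun i hi => hle (hadj i hi)⟩, rfl⟩

/-- The matrix whose row `r` is `e_r` and whose row `i ≠ r` is `e_i - e_{f i}`. -/
def parentMatrix {V : Type*} [DecidableEq V] (r : V) (f : V → V) : Matrix V V ℝ :=
  Matrix.of fun i => if i = r then Pi.single r 1 else Pi.single i 1 - Pi.single (f i) 1

theorem IsParentMap.det_parentMatrix {V : Type*} [Fintype V] [DecidableEq V] {r : V}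
    {f : V → V} (hf : IsParentMap r f) : (parentMatrix r f).det = 1 := by
  obtain ⟨d, hd⟩ := hf.2
  have hoff : ∀ i j, i ≠ j → d i ≤ d j → parentMatrix r f i j = 0 := by
    intro i j hij hle
    by_cases hi : i = r
    · subst hi
      simp [parentMatrix, hij.symm]
    · have : j ≠ f i := by
        rintro rfl
        exact absurd (hd i hi) (not_lt.2 hle)
      simp [parentMatrix, hi, hij.symm, this]
  have hdiag : ∀ i, parentMatrix r f i i = 1 := by
    intro i
    by_cases hi : i = r
    · simp [parentMatrix, hi]
    · simp [parentMatrix, hi, (hf.apply_ne hi).symm]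
  have htri : (parentMatrix r f).BlockTriangular fun i => OrderDual.toDual (d i) := by
    intro i j hij
    have hlt : d i < d j := OrderDual.toDual_lt_toDual.1 hij
    exact hoff i j (fun h => (h ▸ hlt).ne rfl) hlt.le
  rw [htri.det]
  refine Finset.prod_eq_one fun a _ => ?_
  rw [show (parentMatrix r f).toSquareBlock (fun i => OrderDual.toDual (d i)) a = 1 from ?_,
    Matrix.det_one]
  ext ⟨i, hi⟩ ⟨j, hj⟩
  rw [Matrix.toSquareBlock_def, Matrix.of_apply, Matrix.one_apply]
  split_ifs with h
  · rw [Subtype.mk.injEq] at h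
    exact h ▸ hdiag i
  · exact hoff i j (fun h' => h (Subtype.ext h')) (OrderDual.toDual.injective (hi.trans hj.symm)).le

theorem det_parentMatrix_eq_zero {V : Type*} [Fintype V] [DecidableEq V] {r : V}
    {f : V → V} (hr : f r = r) (hf : ¬ IsParentMap r f) : (parentMatrix r f).det = 0 := by
  have hex : ∃ i, ∀ n, f^[n] i ≠ r := by
    by_contra! hreach
    refine hf ⟨hr, fun i => Nat.find (hreach i), fun i hi => ?_⟩
    have hspec := Nat.find_spec (hreach i)
    cases hn : Nat.find (hreach i) with
    | zero =>
      rw [hn] at hspec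
      exact absurd hspec hi
    | succ n =>
      rw [hn, Function.iterate_succ_apply] at hspec
      exact (Nat.lt_succ_of_le (Nat.find_min' (hreach (f i)) hspec)).trans_eq hn.symm
  obtain ⟨i₀, hi₀⟩ := hex
  refine Matrix.exists_mulVec_eq_zero_iff.1
    ⟨fun i => if ∀ n, f^[n] i ≠ r then 1 else 0, ?_, ?_⟩
  · intro h
    simpa [hi₀] using congrFun h i₀
  · ext i
    by_cases hi : i = r
    · subst hi
      have : ¬ ∀ n, f^[n] i ≠ i := fun h => h 0 rfl
      simp [Matrix.mulVec, parentMatrix, this]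
    · have : (∀ n, f^[n] i ≠ r) ↔ ∀ n, f^[n] (f i) ≠ r := by
        refine ⟨fun h n => h (n + 1), fun h n => ?_⟩
        cases n with
        | zero => exact hi
        | succ n => exact h n
      simp only [Matrix.mulVec, parentMatrix, Matrix.of_apply, hi, if_false, sub_dotProduct,
        single_dotProduct, one_mul, Pi.zero_apply, this, sub_self]

/-- The **matrix tree theorem**: every principal cofactor of the Laplacian matrix counts the
spanning trees. -/
theorem adjugate_lapMatrix_apply_self {V : Type*} [Fintype V] [DecidableEq V]
    (G : SimpleGraph V) [DecidableRel G.Adj] (r : V) :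
    (G.lapMatrix ℝ).adjugate r r = (spanningTrees G).card := by
  let g : V → V → V → ℝ := fun i j =>
    if i = r then (if j = r then Pi.single r 1 else 0)
    else if G.Adj i j then Pi.single i 1 - Pi.single j 1 else 0
  have hrows : (G.lapMatrix ℝ).updateRow r (Pi.single r 1) = fun i => ∑ j, g i j := by
    ext i k
    by_cases hi : i = r
    · subst hi
      simp [g, Finset.sum_apply, ite_apply]
    · rw [Matrix.updateRow_ne hi]
      simp only [g, hi, if_false, Finset.sum_apply, SimpleGraph.lapMatrix,
        SimpleGraph.degMatrix, Matrix.sub_apply, Matrix.diagonal_apply,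
        SimpleGraph.adjMatrix_apply, SimpleGraph.degree_eq_sum_if_adj]
      have : ∀ j, (if G.Adj i j then (Pi.single i 1 - Pi.single j 1 : V → ℝ) else 0) k =
          (if i = k then (if G.Adj i j then 1 else 0) else 0) -
            (if j = k then (if G.Adj i j then 1 else 0) else 0) := by
        intro j
        by_cases h : G.Adj i j <;> simp [h, Pi.single_apply, eq_comm]
      rw [Finset.sum_congr rfl fun j _ => this j, Finset.sum_sub_distrib]
      by_cases hik : i = k <;> simp [hik]
  have hterm : ∀ f : V → V, Matrix.det (fun i => g i (f i)) =
      if IsParentMap r f ∧ ∀ i, i ≠ r → G.Adj i (f i) then 1 else 0 := by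
    intro f
    by_cases hr : f r = r
    · by_cases hG : ∀ i, i ≠ r → G.Adj i (f i)
      · have : (fun i => g i (f i)) = parentMatrix r f := by
          ext i j
          by_cases hi : i = r
          · subst hi
            simp [g, parentMatrix, hr]
          · simp [g, parentMatrix, hi, hG i hi]
        rw [this]
        by_cases hf : IsParentMap r f
        · rw [hf.det_parentMatrix, if_pos ⟨hf, hG⟩]
        · rw [det_parentMatrix_eq_zero hr hf, if_neg fun h => hf h.1]
      · rw [if_neg fun h => hG h.2]
        push Not at hG
        obtain ⟨i, hi, hadj⟩ := hG
        exact Matrix.det_eq_zero_of_row_eq_zero i fun j => by simp [g, hi, hadj]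
    · rw [if_neg fun h => hr h.1.1]
      exact Matrix.det_eq_zero_of_row_eq_zero r fun j => by simp [g, hr]
  rw [Matrix.adjugate_apply, hrows]
  refine (Matrix.detRowAlternating.toMultilinearMap.map_sum g).trans ?_
  refine (Finset.sum_congr rfl fun f _ => hterm f).trans ?_
  rw [Finset.sum_boole, ← card_spanningTrees_eq_card_parentMaps G r]
  congr!

theorem hasDerivAt_matrix_det {n : Type*} [Fintype n] [DecidableEq n] {M : ℝ → Matrix n n ℝ}
    {M' : Matrix n n ℝ} {t : ℝ} (hM : ∀ i j, HasDerivAt (fun s => M s i j) (M' i j) t) :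
    HasDerivAt (fun s => (M s).det) (∑ i, ((M t).updateRow i (M' i)).det) t := by
  let D : ContinuousMultilinearMap ℝ (fun _ : n => n → ℝ) ℝ :=
    { toMultilinearMap := Matrix.detRowAlternating.toMultilinearMap
      cont := Continuous.matrix_det continuous_id }
  have hM' : HasDerivAt (fun s i => M s i) (fun i => M' i) t :=
    hasDerivAt_pi.2 fun i => hasDerivAt_pi.2 fun j => hM i j
  have h := (D.hasFDerivAt (fun i => M t i)).comp_hasDerivAt t hM'
  rw [ContinuousMultilinearMap.linearDeriv_apply] at h
  exact h

/-- Corollary (generalized characteristic polynomial): for a finite simple graph `G` with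
`ε_G` edges, the generalized characteristic polynomial
`𝓕_G(λ,μ) = det(λI - (𝓐(G) - μ·𝓓(G)))` satisfies `∂𝓕_G/∂μ (0,1) = 2 ε_G κ(G)`,
where `κ(G)` is the number of spanning trees of `G`. -/
theorem partial_mu_genCharPoly_eq {V : Type*} [Fintype V] [DecidableEq V]
    (G : SimpleGraph V) [DecidableRel G.Adj] :
    HasDerivAt
      (fun m : ℝ =>
        ((0 : ℝ) • (1 : Matrix V V ℝ) -
          (G.adjMatrix ℝ - m • Matrix.diagonal (fun i => (G.degree i : ℝ)))).det)
      (2 * (G.edgeFinset.card : ℝ) * ((spanningTrees G).card : ℝ)) 1 := by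
  let M : ℝ → Matrix V V ℝ := fun m => (0 : ℝ) • (1 : Matrix V V ℝ) -
    (G.adjMatrix ℝ - m • Matrix.diagonal (fun i => (G.degree i : ℝ)))
  have hM1 : M 1 = G.lapMatrix ℝ := by
    simp [M, SimpleGraph.lapMatrix, SimpleGraph.degMatrix]
  have hM : ∀ i j, HasDerivAt (fun m => M m i j)
      (Matrix.diagonal (fun i => (G.degree i : ℝ)) i j) 1 := by
    intro i j
    have h := (((hasDerivAt_id (1 : ℝ)).mul_const
      (Matrix.diagonal (fun i => (G.degree i : ℝ)) i j)).const_sub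
        (G.adjMatrix ℝ i j)).const_sub ((0 : ℝ) * (1 : Matrix V V ℝ) i j)
    simpa [M] using h
  have hrow : ∀ i, Matrix.diagonal (fun i => (G.degree i : ℝ)) i =
      (G.degree i : ℝ) • (Pi.single i 1 : V → ℝ) := by
    intro i
    ext j
    simp [Matrix.diagonal_apply, Pi.single_apply, eq_comm]
  convert hasDerivAt_matrix_det hM using 1
  simp only [hM1, hrow, Matrix.det_updateRow_smul, ← Matrix.adjugate_apply,
    adjugate_lapMatrix_apply_self, ← Finset.sum_mul]
  rw [← Nat.cast_sum, SimpleGraph.sum_degrees_eq_twice_card_edges]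
  push_cast
  ring
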